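/- The following elliptic theta-function identity holds (it is the identity to which the eigenvector property of the boundary state is reduced): for all real u, v, c, k, [v+k+c−1/2]·[v−c−1/2] · ( [c−u][k+c+u][u+v+1/2−k][v−u+1/2] − [c+u][k+c−u][−u+v+1/2−k][v+u+1/2] ) = [−v+k+c−1/2]·[−v−c−1/2] · ( [c−u][k+c+u][u−v+1/2−k][−v−u+1/2] − [c+u][k+c−u][−u−v+1/2−k][−v+u+1/2] ). Equivalently (wherever both denominators are nonzero), [v+k+c−1/2][v−c−1/2] / ([−v+k+c−1/2][−v−c−1/2]) equals the ratio of the two bracketed differences above. -/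

import Mathlib

noncomputable section

namespace ABF

/-- The infinite product `(z;q)_∞`. -/
def poch (z q : ℝ) : ℝ := ∏' j : ℕ, (1 - q ^ j * z)

/-- The theta function `Θ_q(z) = (q;q)_∞ (z;q)_∞ (q/z;q)_∞`. -/
def theta (q z : ℝ) : ℝ := poch q q * poch z q * poch (q / z) q

/-- The elliptic theta function `[u] = x^{u²/r−u} Θ_{x^{2r}}(x^{2u})`. -/
def bra (x r u : ℝ) : ℝ := x ^ (u ^ 2 / r - u) * theta (x ^ (2 * r)) (x ^ (2 * u))

open Filter Topology

/-- Finite product `(q;q)_m`. -/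
def fq (q : ℝ) (m : ℕ) : ℝ := ∏ j ∈ Finset.range m, (1 - q ^ j * q)

/-- `1/(q;q)_m`, extended by zero to negative integers. -/
def iq (q : ℝ) (m : ℤ) : ℝ := if 0 ≤ m then (fq q m.toNat)⁻¹ else 0

lemma fq_succ (q : ℝ) (m : ℕ) : fq q (m + 1) = fq q m * (1 - q ^ m * q) := by
  simp [fq, Finset.prod_range_succ]

lemma fac_pos {q : ℝ} (h0 : 0 < q) (h1 : q < 1) (m : ℕ) : 0 < 1 - q ^ m * q := by
  have : q ^ m ≤ 1 := pow_le_one₀ h0.le h1.le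
  nlinarith

lemma fq_pos {q : ℝ} (h0 : 0 < q) (h1 : q < 1) (m : ℕ) : 0 < fq q m :=
  Finset.prod_pos fun j _ => fac_pos h0 h1 j

lemma fq_anti {q : ℝ} (h0 : 0 < q) (h1 : q < 1) : Antitone (fq q) := by
  refine antitone_nat_of_succ_le fun m => ?_
  rw [fq_succ]
  have h2 := fq_pos h0 h1 m
  have : 0 < q ^ m * q := by positivity
  nlinarith

lemma iq_rec {q : ℝ} (h0 : 0 < q) (h1 : q < 1) (m : ℤ) :
    iq q (m - 1) = (1 - q ^ m) * iq q m := by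
  rcases lt_trichotomy m 0 with h | h | h
  · simp [iq, not_le.mpr h, show ¬ (1 ≤ m) by omega]
  · subst h; simp [iq]
  · obtain ⟨k, rfl⟩ : ∃ k : ℕ, m = k + 1 := ⟨(m - 1).toNat, by omega⟩
    have e : ((k : ℤ) + 1).toNat = k + 1 := by omega
    have h2 := (fq_pos h0 h1 k).ne'
    have h3 := (fac_pos h0 h1 k).ne'
    have e2 : q ^ ((k : ℤ) + 1) = q ^ k * q := by
      rw [zpow_add₀ h0.ne']; simp
    simp only [iq, add_sub_cancel_right, e, fq_succ, e2]
    rw [if_pos (by omega), if_pos (by omega)]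
    simp only [Int.toNat_natCast]
    field_simp

lemma finite_triple {q z : ℝ} (h0 : 0 < q) (h1 : q < 1) (hz : 0 < z) (g : ℤ → ℝ)
    (g0 : g 0 = 1) (gs : ∀ n, g (n + 1) = z * q ^ n * g n) (N : ℕ) :
    HasSum (fun n : ℤ => fq q (2 * N) * iq q (N + n) * iq q (N - n) * ((-1) ^ n * g n))
      ((∏ j ∈ Finset.range N, (1 - q ^ j * z)) * ∏ j ∈ Finset.range N, (1 - q ^ j * (q / z))) := by
  induction N with
  | zero =>
    have := hasSum_single (f := fun n : ℤ => fq q (2 * (0 : ℕ)) * iq q (((0 : ℕ) : ℤ) + n) *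
      iq q (((0 : ℕ) : ℤ) - n) * ((-1) ^ n * g n)) 0 (by
        intro n hn
        rcases lt_or_gt_of_ne hn with h | h
        · simp [iq, not_le.mpr h]
        · simp [iq, not_le.mpr h])
    simpa [iq, fq, g0] using this
  | succ N ih =>
    have s1 := (Equiv.addRight (1 : ℤ)).hasSum_iff.mpr ih
    have s2 := (Equiv.subRight (1 : ℤ)).hasSum_iff.mpr ih
    have key := ((ih.mul_left (1 + q ^ (2 * N + 1))).sub (s2.mul_left (q ^ N * z))).sub
      (s1.mul_left (q ^ (N + 1) / z))
    have hfun : ∀ (f f' : ℤ → ℝ) (a a' : ℝ), HasSum f a → (∀ n, f' n = f n) → a' = a →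
        HasSum f' a' := by
      intro f f' a a' h h1 h2
      rw [h2, funext h1]; exact h
    refine hfun _ _ _ _ key ?_ ?_
    · intro n
      simp only [Function.comp, Equiv.coe_addRight, Equiv.subRight_apply]
      have r1 : iq q (N + n) = (1 - q ^ ((N : ℤ) + 1 + n)) * iq q (N + 1 + n) := by
        rw [← iq_rec h0 h1]; congr 1; ring
      have r2 : iq q (N - n) = (1 - q ^ ((N : ℤ) + 1 - n)) * iq q (N + 1 - n) := by
        rw [← iq_rec h0 h1]; congr 1; ring
      have r3 : iq q (N + (n - 1)) = (1 - q ^ ((N : ℤ) + n)) * iq q (N + n) := by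
        rw [← iq_rec h0 h1]; congr 1; ring
      have r4 : iq q (N - (n + 1)) = (1 - q ^ ((N : ℤ) - n)) * iq q (N - n) := by
        rw [← iq_rec h0 h1]; congr 1; ring
      have r5 : (N : ℤ) - (n - 1) = N + 1 - n := by ring
      have r6 : (N : ℤ) + (n + 1) = N + 1 + n := by ring
      have gp : g (n - 1) = q / (z * q ^ n) * g n := by
        have := gs (n - 1)
        rw [sub_add_cancel, zpow_sub₀ h0.ne', zpow_one] at this
        rw [this]
        have := (zpow_pos h0 n).ne'
        field_simp
      have m1 : (-1 : ℝ) ^ (n + 1) = - (-1) ^ n := by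
        rw [zpow_add₀ (by norm_num)]; simp
      have m2 : (-1 : ℝ) ^ (n - 1) = - (-1) ^ n := by
        rw [zpow_sub₀ (by norm_num), zpow_one, div_neg, div_one]
      rw [r3, r4, r5, r6, r1, r2, gs, gp, m1, m2, show 2 * (N + 1) = 2 * N + 1 + 1 by ring,
        fq_succ, fq_succ]
      push_cast
      have hq := h0.ne'
      simp only [zpow_add₀ hq, zpow_sub₀ hq, zpow_one, zpow_natCast]
      have hY := (zpow_pos h0 n).ne'
      generalize q ^ n = Y at *
      generalize iq q (N + 1 + n) = A at *
      generalize iq q (N + 1 - n) = B at *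
      generalize (-1 : ℝ) ^ n = M at *
      have e1 : q ^ (2 * N + 1 + 1) = (q ^ N) ^ 2 * q ^ 2 := by ring
      have e2 : q ^ (2 * N + 1) = (q ^ N) ^ 2 * q := by ring
      have e3 : q ^ (2 * N) = (q ^ N) ^ 2 := by ring
      simp only [e2, e3, pow_succ q N]
      generalize q ^ N = X at *
      field_simp
      ring
    · rw [Finset.prod_range_succ, Finset.prod_range_succ]
      field_simp
      ring

lemma poch_tendsto {q : ℝ} (h0 : 0 < q) (h1 : q < 1) (z : ℝ) :
    Tendsto (fun N => ∏ j ∈ Finset.range N, (1 - q ^ j * z)) atTop (𝓝 (poch z q)) := by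
  have hs : Summable fun j : ℕ => -(q ^ j * z) :=
    ((summable_geometric_of_lt_one h0.le h1).mul_right z).neg
  have := (Real.multipliable_one_add_of_summable hs).hasProd.tendsto_prod_nat
  simpa [poch, sub_eq_add_neg] using this

lemma triple {q : ℝ} (h0 : 0 < q) (h1 : q < 1) :
    ∃ C : ℝ, ∀ (z : ℝ) (_ : 0 < z) (g : ℤ → ℝ) (_ : g 0 = 1)
      (_ : ∀ n, g (n + 1) = z * q ^ n * g n) (_ : ∀ n, 0 ≤ g n) (_ : Summable g),
      theta q z = C * ∑' n : ℤ, (-1) ^ n * g n := by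
  have hF : Tendsto (fq q) atTop (𝓝 (poch q q)) := poch_tendsto h0 h1 q
  have hle : ∀ m, poch q q ≤ fq q m := fun m => (fq_anti h0 h1).le_of_tendsto hF m
  have hP0 : 0 ≤ poch q q := ge_of_tendsto' hF fun m => (fq_pos h0 h1 m).le
  rcases hP0.eq_or_lt with hP | hP
  · exact ⟨0, fun z _ g _ _ _ _ => by simp [theta, ← hP]⟩
  refine ⟨1, fun z hz g g0 gs gn gsum => ?_⟩
  set P := poch q q with hPdef
  have hI : ∀ m, 0 ≤ iq q m ∧ iq q m ≤ P⁻¹ := by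
    intro m
    unfold iq
    split_ifs
    · exact ⟨(inv_pos.mpr (fq_pos h0 h1 _)).le, inv_anti₀ hP (hle _)⟩
    · exact ⟨le_rfl, (inv_pos.mpr hP).le⟩
  have hF1 : ∀ m, fq q m ≤ 1 := fun m => by
    have := fq_anti h0 h1 (Nat.zero_le m)
    simpa [fq] using this
  have hIt : Tendsto (fun m : ℕ => iq q m) atTop (𝓝 P⁻¹) := by
    have := hF.inv₀ hP.ne'
    refine this.congr fun m => ?_
    simp [iq]
  have hIt' : Tendsto (iq q) atTop (𝓝 P⁻¹) := by
    have h := hIt.comp (tendsto_atTop_atTop.mpr fun b => ⟨(b : ℤ), fun a ha => by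
      show b ≤ a.toNat
      omega⟩ : Tendsto Int.toNat atTop atTop)
    refine h.congr' ?_
    filter_upwards [eventually_ge_atTop (0 : ℤ)] with a ha
    simp [Function.comp, Int.toNat_of_nonneg ha]
  have hlim : Tendsto (fun N : ℕ => ∑' n : ℤ,
      fq q (2 * N) * iq q (N + n) * iq q (N - n) * ((-1) ^ n * g n)) atTop
      (𝓝 (∑' n : ℤ, P * P⁻¹ * P⁻¹ * ((-1) ^ n * g n))) := by
    refine tendsto_tsum_of_dominated_convergence (bound := fun n => P⁻¹ * P⁻¹ * g n)
      (gsum.mul_left _) ?_ ?_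
    · intro n
      have hc : Tendsto (fun N : ℕ => (N : ℤ)) atTop atTop := tendsto_natCast_atTop_atTop
      have t1 := hIt'.comp (tendsto_atTop_add_const_right _ n hc)
      have t2 := hIt'.comp (tendsto_atTop_add_const_right _ (-n) hc)
      have t3 := hF.comp (tendsto_id.const_mul_atTop' (show 0 < 2 by norm_num))
      exact ((t3.mul t1).mul t2).mul_const _
    · refine Eventually.of_forall fun N n => ?_
      have a1 := hI (N + n)
      have a2 := hI (N - n)
      have a3 := hF1 (2 * N)
      have a4 := (fq_pos h0 h1 (2 * N)).le
      have e : ‖fq q (2 * N) * iq q (N + n) * iq q (N - n) * ((-1) ^ n * g n)‖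
          = fq q (2 * N) * iq q (N + n) * iq q (N - n) * g n := by
        simp only [norm_mul, norm_zpow, norm_neg, norm_one, one_zpow, one_mul]
        rw [Real.norm_of_nonneg a4, Real.norm_of_nonneg a1.1, Real.norm_of_nonneg a2.1,
          Real.norm_of_nonneg (gn n)]
      rw [e]
      refine mul_le_mul_of_nonneg_right ?_ (gn n)
      refine mul_le_mul ?_ a2.2 a2.1 (inv_pos.mpr hP).le
      calc _ ≤ 1 * P⁻¹ := mul_le_mul a3 a1.2 a1.1 zero_le_one
        _ = P⁻¹ := one_mul _
  have hlim2 := (poch_tendsto h0 h1 z).mul (poch_tendsto h0 h1 (q / z))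
  have hu := tendsto_nhds_unique hlim
    (hlim2.congr fun N => ((finite_triple h0 h1 hz g g0 gs N).tsum_eq).symm)
  rw [tsum_mul_left] at hu
  rw [theta, mul_assoc, ← hu, ← hPdef]
  field_simp

lemma summable_gauss {x : ℝ} (hx0 : 0 < x) (hx1 : x < 1) {a : ℝ} (ha : 0 < a) (b c : ℝ) :
    Summable fun n : ℤ => x ^ (a * (n : ℝ) ^ 2 + b * n + c) := by
  have hl : Real.log x < 0 := Real.log_neg hx0 hx1
  have h := (summable_jacobiTheta₂_term_iff
    (Complex.I * (-(b * Real.log x) / (2 * Real.pi) : ℝ))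
    (Complex.I * (-(a * Real.log x) / Real.pi : ℝ))).mpr (by
      simp only [Complex.mul_im, Complex.I_re, Complex.I_im, Complex.ofReal_re, Complex.ofReal_im]
      have := Real.pi_pos
      have : 0 < -(a * Real.log x) / Real.pi := by
        apply div_pos _ this; nlinarith
      linarith)
  have h2 := h.norm.mul_right (x ^ c)
  refine h2.congr fun n => ?_
  rw [norm_jacobiTheta₂_term, Real.rpow_def_of_pos hx0, Real.rpow_def_of_pos hx0, ← Real.exp_add]
  congr 1
  simp only [Complex.mul_im, Complex.I_re, Complex.I_im, Complex.ofReal_re, Complex.ofReal_im]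
  have := Real.pi_ne_zero
  field_simp
  ring

/-- The summand of the series of the bracket. -/
def tm (x r u : ℝ) (n : ℤ) : ℝ := (-1) ^ n * x ^ ((u + r * (n - 1 / 2)) ^ 2 / r)

lemma summable_sq {x : ℝ} (hx0 : 0 < x) (hx1 : x < 1) {r a : ℝ} (hr : 0 < r) (ha : a ≠ 0)
    (b : ℝ) : Summable fun n : ℤ => x ^ ((a * n + b) ^ 2 / r) := by
  refine (summable_gauss hx0 hx1 (a := a ^ 2 / r) (by positivity) (2 * a * b / r)
    (b ^ 2 / r)).congr fun n => ?_
  congr 1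
  ring

lemma summable_tm_norm {x : ℝ} (hx0 : 0 < x) (hx1 : x < 1) {r : ℝ} (hr : 0 < r) (u : ℝ) :
    Summable fun n => ‖tm x r u n‖ := by
  refine (summable_sq hx0 hx1 hr hr.ne' (u - r / 2)).congr fun n => ?_
  simp only [tm, norm_mul, norm_zpow, norm_neg, norm_one, one_zpow, one_mul]
  rw [Real.norm_of_nonneg (by positivity)]
  congr 2
  ring

lemma bra_series {x : ℝ} (hx0 : 0 < x) (hx1 : x < 1) {r : ℝ} (hr : 0 < r) :
    ∃ C : ℝ, ∀ u, bra x r u = C * ∑' n, tm x r u n := by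
  obtain ⟨C, hC⟩ := triple (q := x ^ (2 * r)) (by positivity)
    (Real.rpow_lt_one hx0.le hx1 (by positivity))
  refine ⟨C * x ^ (-(r / 4)), fun u => ?_⟩
  rw [bra, hC (x ^ (2 * u)) (by positivity) (fun n => x ^ (r * n * (n - 1) + 2 * u * n))]
  · rw [mul_left_comm, mul_assoc]
    congr 1
    rw [← tsum_mul_left, ← tsum_mul_left]
    congr 1
    funext n
    rw [tm, mul_left_comm, mul_left_comm (x ^ (-(r / 4))), ← Real.rpow_add hx0,
      ← Real.rpow_add hx0]
    congr 2
    field_simp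
    ring
  · simp
  · intro n
    rw [← Real.rpow_intCast, ← Real.rpow_mul hx0.le, ← Real.rpow_add hx0, ← Real.rpow_add hx0]
    congr 1
    push_cast
    ring
  · intro n; positivity
  · refine (summable_gauss hx0 hx1 hr (2 * u - r) 0).congr fun n => ?_
    congr 1
    ring

lemma tm_odd (x r u : ℝ) : ∑' n, tm x r (-u) n = - ∑' n, tm x r u n := by
  rw [← (Equiv.subLeft (1 : ℤ)).tsum_eq (tm x r (-u)), ← tsum_neg]
  congr 1
  funext n
  simp only [Equiv.subLeft_apply, tm]
  rw [zpow_sub₀ (by norm_num)]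
  have : ((-1 : ℝ) ^ n)⁻¹ = (-1) ^ n := by
    rw [← inv_zpow]; norm_num
  rw [div_eq_mul_inv, this]
  push_cast
  rw [show (-u + r * (1 - (n : ℝ) - 1 / 2)) ^ 2 = (u + r * (n - 1 / 2)) ^ 2 by ring]
  ring

/-- Even and odd degree-two theta functions. -/
def Ev (x r a : ℝ) : ℝ := ∑' j : ℤ, x ^ ((2 * r * j + 2 * a) ^ 2 / (2 * r))

def Od (x r a : ℝ) : ℝ := ∑' j : ℤ, x ^ ((2 * r * j + (2 * a + r)) ^ 2 / (2 * r))

/-- Splitting pairs of integers by the parity of the sum. -/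
def splitEquiv : (ℤ × ℤ) ⊕ (ℤ × ℤ) ≃ ℤ × ℤ where
  toFun := Sum.elim (fun p => (p.1 + p.2 + 1, p.1 - p.2)) (fun p => (p.1 + p.2 + 1, p.1 - p.2 + 1))
  invFun p := if (p.1 + p.2) % 2 = 0 then Sum.inr ((p.1 + p.2 - 2) / 2, (p.1 - p.2) / 2)
    else Sum.inl ((p.1 + p.2 - 1) / 2, (p.1 - p.2 - 1) / 2)
  left_inv := by
    rintro (⟨a, b⟩ | ⟨a, b⟩)
    · show (if (a + b + 1 + (a - b)) % 2 = 0 then _ else _) = _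
      rw [if_neg (by omega)]
      simp only [Sum.elim_inl]
      congr 2 <;> omega
    · show (if (a + b + 1 + (a - b + 1)) % 2 = 0 then _ else _) = _
      rw [if_pos (by omega)]
      simp only [Sum.elim_inr]
      congr 2 <;> omega
  right_inv := by
    rintro ⟨a, b⟩
    dsimp only
    split_ifs with h
    · simp only [Sum.elim_inr]
      ext <;> dsimp only <;> omega
    · simp only [Sum.elim_inl]
      ext <;> dsimp only <;> omega

lemma tm_mul {x : ℝ} (hx0 : 0 < x) (hx1 : x < 1) {r : ℝ} (hr : 0 < r) (a b : ℝ) :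
    (∑' n, tm x r (a + b) n) * (∑' n, tm x r (a - b) n)
      = Od x r a * Ev x r b - Ev x r a * Od x r b := by
  have h1 := summable_tm_norm hx0 hx1 hr (a + b)
  have h2 := summable_tm_norm hx0 hx1 hr (a - b)
  have hE : ∀ t, Summable fun j : ℤ => ‖x ^ ((2 * r * j + 2 * t) ^ 2 / (2 * r))‖ := fun t =>
    (summable_sq hx0 hx1 (r := 2 * r) (by positivity) (by positivity) (2 * t)).norm
  have hO : ∀ t, Summable fun j : ℤ => ‖x ^ ((2 * r * j + (2 * t + r)) ^ 2 / (2 * r))‖ := fun t =>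
    (summable_sq hx0 hx1 (r := 2 * r) (by positivity) (by positivity) (2 * t + r)).norm
  have hs := summable_mul_of_summable_norm h1 h2
  rw [tsum_mul_tsum_of_summable_norm h1 h2, ← splitEquiv.tsum_eq]
  have hs' := splitEquiv.summable_iff.mpr hs
  have hl := hs'.comp_injective Sum.inl_injective
  have hr' := hs'.comp_injective Sum.inr_injective
  have := (HasSum.sum (f := fun p => tm x r (a + b) (splitEquiv p).1 *
    tm x r (a - b) (splitEquiv p).2) hl.hasSum hr'.hasSum).tsum_eq
  rw [this]
  have sq : ∀ k : ℤ, (-1 : ℝ) ^ k * (-1) ^ k = 1 := fun k => by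
    rw [← mul_zpow]; norm_num
  rw [Od, Ev, Ev, Od, tsum_mul_tsum_of_summable_norm (hO a) (hE b),
    tsum_mul_tsum_of_summable_norm (hE a) (hO b), sub_eq_neg_add (∑' _ : ℤ × ℤ, _) (∑' _ : ℤ × ℤ, _), ← tsum_neg]
  congr 1
  · congr 1
    funext p
    obtain ⟨p, d⟩ := p
    simp only [Function.comp, splitEquiv, Equiv.coe_fn_mk, Sum.elim_inl, tm]
    rw [mul_mul_mul_comm, ← Real.rpow_add hx0, ← Real.rpow_add hx0]
    have e : (-1 : ℝ) ^ (p + d + 1) * (-1) ^ (p - d) = -1 := by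
      rw [← zpow_add₀ (by norm_num), show p + d + 1 + (p - d) = p + p + 1 by ring,
        zpow_add₀ (by norm_num), zpow_add₀ (by norm_num), sq]
      norm_num
    rw [e, neg_one_mul]
    congr 2
    push_cast
    field_simp
    ring
  · congr 1
    funext p
    obtain ⟨p, d⟩ := p
    simp only [Function.comp, splitEquiv, Equiv.coe_fn_mk, Sum.elim_inr, tm]
    rw [mul_mul_mul_comm, ← Real.rpow_add hx0, ← Real.rpow_add hx0]
    have e : (-1 : ℝ) ^ (p + d + 1) * (-1) ^ (p - d + 1) = 1 := by
      rw [← zpow_add₀ (by norm_num), show p + d + 1 + (p - d + 1) = (p + 1) + (p + 1) by ring,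
        zpow_add₀ (by norm_num), sq]
    rw [e, one_mul]
    congr 1
    push_cast
    field_simp
    ring

lemma diff_factor {x : ℝ} (hx0 : 0 < x) (hx1 : x < 1) {r : ℝ} (hr : 0 < r) (u v c k : ℝ) :
    bra x r (c - u) * bra x r (k + c + u) *
        bra x r (u + v + 1 / 2 - k) * bra x r (v - u + 1 / 2) -
      bra x r (c + u) * bra x r (k + c - u) *
        bra x r (-u + v + 1 / 2 - k) * bra x r (v + u + 1 / 2)
      = bra x r (v + c + 1 / 2) * bra x r (-k) * bra x r (k + c - v - 1 / 2) * bra x r (-2 * u) := by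
  obtain ⟨C, hC⟩ := bra_series hx0 hx1 hr
  have F : ∀ s t a b, s = a + b → t = a - b → bra x r s * bra x r t
      = C ^ 2 * (Od x r a * Ev x r b - Ev x r a * Od x r b) := by
    rintro s t a b rfl rfl
    rw [hC, hC, ← tm_mul hx0 hx1 hr]
    ring
  set α := (c + v + 1 / 2 - k) / 2 with hα
  set β := (k + c + v + 1 / 2) / 2 with hβ
  set w := (k + c - v - 1 / 2) / 2 with hw
  have f1 := F (c - u) (u + v + 1 / 2 - k) α (w - u) (by rw [hα, hw]; ring) (by rw [hα, hw]; ring)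
  have f2 := F (k + c + u) (v - u + 1 / 2) β (w + u) (by rw [hβ, hw]; ring) (by rw [hβ, hw]; ring)
  have f3 := F (c + u) (-u + v + 1 / 2 - k) α (w + u) (by rw [hα, hw]; ring)
    (by rw [hα, hw]; ring)
  have f4 := F (k + c - u) (v + u + 1 / 2) β (w - u) (by rw [hβ, hw]; ring)
    (by rw [hβ, hw]; ring)
  have f5 := F (v + c + 1 / 2) (-k) α β (by rw [hα, hβ]; ring) (by rw [hα, hβ]; ring)
  have f6 := F (k + c - v - 1 / 2) (-2 * u) (w - u) (w + u) (by rw [hw]; ring) (by ring)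
  calc _ = (bra x r (c - u) * bra x r (u + v + 1 / 2 - k)) *
          (bra x r (k + c + u) * bra x r (v - u + 1 / 2)) -
        (bra x r (c + u) * bra x r (-u + v + 1 / 2 - k)) *
          (bra x r (k + c - u) * bra x r (v + u + 1 / 2)) := by ring
    _ = (bra x r (v + c + 1 / 2) * bra x r (-k)) *
          (bra x r (k + c - v - 1 / 2) * bra x r (-2 * u)) := by
        rw [f1, f2, f3, f4, f5, f6]; ring
    _ = _ := by ring

lemma bra_odd {x : ℝ} (hx0 : 0 < x) (hx1 : x < 1) {r : ℝ} (hr : 0 < r) (u : ℝ) :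
    bra x r (-u) = - bra x r u := by
  obtain ⟨C, hC⟩ := bra_series hx0 hx1 hr
  rw [hC, hC, tm_odd]
  ring

/-- The elliptic theta-function identity to which the eigenvector property of the boundary
state of the boundary `U_{q,p}(sl₃)` ABF transfer matrix is reduced. -/
theorem boundary_theta_identity
    (x : ℝ) (hx0 : 0 < x) (hx1 : x < 1) (r : ℤ) (hr : 5 ≤ r)
    (u v c k : ℝ) :
    bra x r (v + k + c - 1 / 2) * bra x r (v - c - 1 / 2) *
        (bra x r (c - u) * bra x r (k + c + u) *
            bra x r (u + v + 1 / 2 - k) * bra x r (v - u + 1 / 2) -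
          bra x r (c + u) * bra x r (k + c - u) *
            bra x r (-u + v + 1 / 2 - k) * bra x r (v + u + 1 / 2))
      = bra x r (-v + k + c - 1 / 2) * bra x r (-v - c - 1 / 2) *
          (bra x r (c - u) * bra x r (k + c + u) *
              bra x r (u - v + 1 / 2 - k) * bra x r (-v - u + 1 / 2) -
            bra x r (c + u) * bra x r (k + c - u) *
              bra x r (-u - v + 1 / 2 - k) * bra x r (-v + u + 1 / 2)) := by
  have hr0 : (0 : ℝ) < (r : ℝ) := by exact_mod_cast (by omega : 0 < r)
  have d1 := diff_factor hx0 hx1 hr0 u v c k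
  have d2 := diff_factor hx0 hx1 hr0 u (-v) c k
  rw [show u + -v + 1 / 2 - k = u - v + 1 / 2 - k by ring,
    show -u + -v + 1 / 2 - k = -u - v + 1 / 2 - k by ring] at d2
  rw [d1, d2, show v - c - 1 / 2 = -(-v + c + 1 / 2) by ring,
    show -v - c - 1 / 2 = -(v + c + 1 / 2) by ring, bra_odd hx0 hx1 hr0 (-v + c + 1 / 2),
    bra_odd hx0 hx1 hr0 (v + c + 1 / 2),
    show k + c - v - 1 / 2 = -v + k + c - 1 / 2 by ring,
    show k + c - -v - 1 / 2 = v + k + c - 1 / 2 by ring]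
  ring

end ABF
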